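/- arXiv:1410.0879 — 3 statements merged into one kernel-verified Lean document; each statement's English description precedes it below -/
import Mathlib

section
/- (Optimality, velocity control.) Let G be an acyclic priority graph, v̄_i > 0 for each i, and f^G the associated control law. Let x ∈ χ^free_G and let v be any velocity control whose flow from x remains in χ^free_G for all times t ≥ 0. Then the closed-loop trajectory dominates it componentwise: for all t ≥ 0, φ(t, x, f^G) ≥ φ(t, x, v). -/
open Set

noncomputable section

/-- Canonical basis vector `e i` of the coordination space `ℝ^n`. -/
def basisVec (n : ℕ) (i : Fin n) : Fin n → ℝ := Pi.single i 1

/-- Collision cylinder `χ^obs_{ij} = {x : (x i, x j) ∈ κ i j}`. -/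
def cyl (n : ℕ) (κ : Fin n → Fin n → Set (ℝ × ℝ)) (i j : Fin n) : Set (Fin n → ℝ) :=
  {x | (x i, x j) ∈ κ i j}

/-- Completed cylinder `χ^obs_{i≻j} = χ^obs_{ij} − ℝ₊ e_i + ℝ₊ e_j` (Minkowski sums). -/
def cylPr (n : ℕ) (κ : Fin n → Fin n → Set (ℝ × ℝ)) (i j : Fin n) : Set (Fin n → ℝ) :=
  {z | ∃ y ∈ cyl n κ i j, ∃ a b : ℝ, 0 ≤ a ∧ 0 ≤ b ∧
    z = y - a • basisVec n i + b • basisVec n j}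

/-- Obstacle region `χ^obs = ⋃_{i,j} χ^obs_{ij}`. -/
def obsRegion (n : ℕ) (κ : Fin n → Fin n → Set (ℝ × ℝ)) : Set (Fin n → ℝ) :=
  ⋃ i, ⋃ j, cyl n κ i j

/-- Obstacle-free region `χ^free = χ \ χ^obs`. -/
def freeRegion (n : ℕ) (κ : Fin n → Fin n → Set (ℝ × ℝ)) : Set (Fin n → ℝ) :=
  (obsRegion n κ)ᶜ

/-- Standing hypotheses on the collision data `κ`: each `κ i j` is open, bounded and
convex, `κ i i = ∅`, and `(a,b) ∈ κ i j ↔ (b,a) ∈ κ j i`. -/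
def KappaHyp (n : ℕ) (κ : Fin n → Fin n → Set (ℝ × ℝ)) : Prop :=
  (∀ i j, IsOpen (κ i j)) ∧ (∀ i j, Bornology.IsBounded (κ i j)) ∧
  (∀ i j, Convex ℝ (κ i j)) ∧ (∀ i, κ i i = ∅) ∧
  (∀ (i j : Fin n) (a b : ℝ), (a, b) ∈ κ i j ↔ (b, a) ∈ κ j i)

/-- `PhiMem n C φ` : `φ` restricted to `[0,1]` is a continuous nondecreasing path whose
image lies in `C`, with `φ 0 − ℝ₊^n ⊆ C` and `φ 1 + ℝ₊^n ⊆ C` (the set `Φ(C)`). -/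
def PhiMem (n : ℕ) (C : Set (Fin n → ℝ)) (φ : ℝ → Fin n → ℝ) : Prop :=
  ContinuousOn φ (Icc 0 1) ∧
  (∀ t1 ∈ Icc (0:ℝ) 1, ∀ t2 ∈ Icc (0:ℝ) 1, t1 ≤ t2 → φ t1 ≤ φ t2) ∧
  (∀ t ∈ Icc (0:ℝ) 1, φ t ∈ C) ∧
  (∀ d : Fin n → ℝ, 0 ≤ d → φ 0 - d ∈ C) ∧
  (∀ d : Fin n → ℝ, 0 ≤ d → φ 1 + d ∈ C)

/-- A priority graph: `E i j ↔ (χ^obs_{ij} ≠ ∅ ∧ ¬ E j i)`. -/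
def IsPriorityGraph (n : ℕ) (κ : Fin n → Fin n → Set (ℝ × ℝ))
    (E : Fin n → Fin n → Prop) : Prop :=
  ∀ i j, E i j ↔ (cyl n κ i j ≠ ∅ ∧ ¬ E j i)

/-- Completed obstacle region `χ^obs_G = ⋃_{(i,j) ∈ E(G)} χ^obs_{i≻j}`. -/
def obsG (n : ℕ) (κ : Fin n → Fin n → Set (ℝ × ℝ))
    (E : Fin n → Fin n → Prop) : Set (Fin n → ℝ) :=
  ⋃ i, ⋃ j, ⋃ (_ : E i j), cylPr n κ i j

/-- `χ^free_G = χ \ χ^obs_G`. -/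
def freeG (n : ℕ) (κ : Fin n → Fin n → Set (ℝ × ℝ))
    (E : Fin n → Fin n → Prop) : Set (Fin n → ℝ) :=
  (obsG n κ E)ᶜ

/-- `E` contains a directed cycle. -/
def HasCycle (n : ℕ) (E : Fin n → Fin n → Prop) : Prop :=
  ∃ (m : ℕ) (v : ℕ → Fin n), 0 < m ∧ v m = v 0 ∧ ∀ k < m, E (v k) (v (k+1))

/-- The braking condition of the control law: moving robot `i` at maximal speed for one
time slot while a higher-priority robot `j` (an edge `(j,i)` of `G`) moves at speed
`f x j` would violate the priority `j ≻ i`. -/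
def CtrlCond (n : ℕ) (κ : Fin n → Fin n → Set (ℝ × ℝ)) (E : Fin n → Fin n → Prop)
    (vbar : Fin n → ℝ) (f : (Fin n → ℝ) → Fin n → ℝ) (x : Fin n → ℝ) (i : Fin n) :
    Prop :=
  ∃ j, E j i ∧ ∃ t ∈ Icc (0:ℝ) 1,
    x + t • (vbar i • basisVec n i + f x j • basisVec n j) ∈ cylPr n κ j i

/-- `f` satisfies the fixed-point definition of the priority preserving control law
`f^G` for velocity-controlled robots: `f x i ∈ {0, v̄ i}`, `f x i = 0` when the
braking condition holds, and `f x i = v̄ i` otherwise. -/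
def CtrlLawSpec (n : ℕ) (κ : Fin n → Fin n → Set (ℝ × ℝ)) (E : Fin n → Fin n → Prop)
    (vbar : Fin n → ℝ) (f : (Fin n → ℝ) → Fin n → ℝ) : Prop :=
  (∀ x i, f x i = 0 ∨ f x i = vbar i) ∧
  (∀ x i, (CtrlCond n κ E vbar f x i → f x i = 0) ∧
          (¬ CtrlCond n κ E vbar f x i → f x i = vbar i))

/-- Flow of a (slotwise constant) velocity control `v : ℕ → ℝ^n` from `x`:
`φ(k + τ) = φ(k) + τ • v k` for `k ∈ ℕ` and `τ ∈ [0,1]`. -/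
def flowVel (n : ℕ) (x : Fin n → ℝ) (v : ℕ → Fin n → ℝ) (t : ℝ) : Fin n → ℝ :=
  x + (∑ k ∈ Finset.range ⌊t⌋₊, v k) + (t - (⌊t⌋₊ : ℝ)) • v ⌊t⌋₊

/-- Positions at integer times of the closed-loop system under feedback law `f`. -/
def clSeq (n : ℕ) (f : (Fin n → ℝ) → Fin n → ℝ) (x : Fin n → ℝ) : ℕ → Fin n → ℝ
  | 0 => x
  | k + 1 => clSeq n f x k + f (clSeq n f x k)

/-- Closed-loop flow `φ(·, x, f)`: the flow of the velocity control defined recursively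
by `v k = f (φ(k, x, f))`. -/
def clFlow (n : ℕ) (f : (Fin n → ℝ) → Fin n → ℝ) (x : Fin n → ℝ) (t : ℝ) :
    Fin n → ℝ :=
  flowVel n x (fun k => f (clSeq n f x k)) t

/-- A point belongs to the completed cylinder `i ≻ j` iff some collision point of `κ i j`
is weakly ahead of it in the coordinate `i` and weakly behind it in the coordinate `j`. -/
theorem mem_cylPr_iff {n : ℕ} {κ : Fin n → Fin n → Set (ℝ × ℝ)} {i j : Fin n} (hij : i ≠ j)
    (z : Fin n → ℝ) :
    z ∈ cylPr n κ i j ↔ ∃ p q : ℝ, (p, q) ∈ κ i j ∧ z i ≤ p ∧ q ≤ z j := by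
  constructor
  · rintro ⟨y, hy, a, b, ha, hb, rfl⟩
    refine ⟨y i, y j, hy, ?_, ?_⟩ <;> simpa [basisVec, hij, hij.symm]
  · rintro ⟨p, q, hpq, hp, hq⟩
    refine ⟨z + (p - z i) • basisVec n i - (z j - q) • basisVec n j, ?_, p - z i, z j - q,
      sub_nonneg.2 hp, sub_nonneg.2 hq, by abel⟩
    simpa [cyl, basisVec, hij, hij.symm] using hpq

theorem wellFounded_of_not_hasCycle {n : ℕ} {E : Fin n → Fin n → Prop}
    (h : ¬ HasCycle n E) : WellFounded E := by
  rw [wellFounded_iff_isEmpty_descending_chain]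
  refine ⟨fun ⟨g, hg⟩ => h ?_⟩
  have hcycle : ∀ a b : ℕ, a < b → g a = g b → HasCycle n E := by
    intro a b hab heq
    refine ⟨b - a, fun k => g (b - k), by omega, ?_, fun k hk => ?_⟩
    · simp [Nat.sub_sub_self hab.le, heq]
    · have := hg (b - (k + 1))
      rwa [show b - (k + 1) + 1 = b - k by omega] at this
  obtain ⟨a, b, hab, heq⟩ := Finite.exists_ne_map_eq_of_infinite g
  rcases lt_or_gt_of_ne hab with hlt | hlt
  · exact hcycle a b hlt heq
  · exact hcycle b a hlt heq.symm

theorem flowVel_natCast_add {n : ℕ} (x : Fin n → ℝ) (v : ℕ → Fin n → ℝ) (k : ℕ) {t : ℝ}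
    (ht : t ∈ Icc (0 : ℝ) 1) :
    flowVel n x v (k + t) = x + ∑ l ∈ Finset.range k, v l + t • v k := by
  rcases ht.2.lt_or_eq with h1 | rfl
  · have hfloor : ⌊(k : ℝ) + t⌋₊ = k := by
      rw [Nat.floor_eq_iff (by linarith [ht.1, k.cast_nonneg (α := ℝ)])]
      constructor <;> linarith [ht.1]
    simp [flowVel, hfloor]
  · have hfloor : ⌊(k : ℝ) + 1⌋₊ = k + 1 := by exact_mod_cast Nat.floor_natCast (R := ℝ) (k + 1)
    simp [flowVel, hfloor, Finset.sum_range_succ, add_assoc]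

theorem clSeq_eq_sum {n : ℕ} (f : (Fin n → ℝ) → Fin n → ℝ) (x : Fin n → ℝ) (k : ℕ) :
    clSeq n f x k = x + ∑ l ∈ Finset.range k, f (clSeq n f x l) := by
  induction k with
  | zero => simp [clSeq]
  | succ k ih => rw [clSeq, Finset.sum_range_succ, ← add_assoc, ← ih]

theorem exists_int_sum_sub_sum {u w : ℕ → ℝ} {c : ℝ} (hu : ∀ k, u k = 0 ∨ u k = c)
    (hw : ∀ k, w k = 0 ∨ w k = c) (k : ℕ) :
    ∃ m : ℤ, ∑ l ∈ Finset.range k, u l - ∑ l ∈ Finset.range k, w l = m * c := by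
  induction k with
  | zero => exact ⟨0, by simp⟩
  | succ k ih =>
    obtain ⟨m, hm⟩ := ih
    simp only [Finset.sum_range_succ]
    rcases hu k with h | h <;> rcases hw k with h' | h' <;> rw [h, h']
    · exact ⟨m, by linarith⟩
    · exact ⟨m - 1, by push_cast; linarith⟩
    · exact ⟨m + 1, by push_cast; linarith⟩
    · exact ⟨m, by linarith⟩

theorem add_mul_le_add_mul_of_endpoints {a b p q t : ℝ} (h0 : a ≤ p) (h1 : a + b ≤ p + q)
    (ht : t ∈ Icc (0 : ℝ) 1) : a + t * b ≤ p + t * q := by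
  nlinarith [mul_nonneg ht.1 (sub_nonneg.2 h1),
    mul_nonneg (sub_nonneg.2 ht.2) (sub_nonneg.2 h0)]

/-- The domination at the beginning of a time slot propagates to its end, by induction along
the priority graph. -/
theorem slot_domination {n : ℕ} {κ : Fin n → Fin n → Set (ℝ × ℝ)} {E : Fin n → Fin n → Prop}
    (hne : ∀ i j, E i j → i ≠ j) (hwf : WellFounded E) {vbar : Fin n → ℝ}
    (hv : ∀ i, 0 < vbar i) {f : (Fin n → ℝ) → Fin n → ℝ} (hf : CtrlLawSpec n κ E vbar f)
    {y z w : Fin n → ℝ} (hw : ∀ i, w i = 0 ∨ w i = vbar i)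
    (hfree : ∀ t ∈ Icc (0 : ℝ) 1, y + t • w ∈ freeG n κ E) (hyz : y ≤ z)
    (hgap : ∀ i, ∃ m : ℤ, z i - y i = m * vbar i) : y + w ≤ z + f z := by
  intro i
  induction i using hwf.induction with
  | _ i ih =>
  simp only [Pi.add_apply] at ih ⊢
  have hi := hv i
  have hyzi := hyz i
  rcases hw i with hwi | hwi
  · rcases hf.1 z i with h | h <;> linarith
  by_cases hbrake : CtrlCond n κ E vbar f z i
  swap
  · rw [(hf.2 z i).2 hbrake]
    linarith
  rw [(hf.2 z i).1 hbrake]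
  obtain ⟨m, hm⟩ := hgap i
  have hm0 : 0 ≤ m := by
    have : 0 ≤ (m : ℝ) := nonneg_of_mul_nonneg_left (by linarith) hi
    exact_mod_cast this
  rcases hm0.eq_or_lt with rfl | hpos
  · exfalso
    obtain ⟨j, hji, t, ht, hmem⟩ := hbrake
    have hne' := hne j i hji
    obtain ⟨p, q, hpq, hp, hq⟩ := (mem_cylPr_iff hne' _).1 hmem
    simp [basisVec, hne', hne'.symm] at hp hq hm
    refine hfree t ht (mem_iUnion₂.2 ⟨j, i, mem_iUnion.2 ⟨hji, ?_⟩⟩)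
    refine (mem_cylPr_iff hne' _).2 ⟨p, q, hpq, ?_, ?_⟩
    · exact (add_mul_le_add_mul_of_endpoints (hyz j) (ih j hji) ht).trans hp
    · simp only [Pi.add_apply, Pi.smul_apply, smul_eq_mul, hwi]
      linarith
  · have : (1 : ℝ) ≤ m := by exact_mod_cast hpos
    nlinarith

/-- optimality, velocity control: the closed-loop trajectory of the
control law `f^G` dominates, componentwise at all times, the flow of any velocity
control that keeps the system in `χ^free_G`. -/
theorem stmt17 (n : ℕ) (hn : 1 ≤ n) (κ : Fin n → Fin n → Set (ℝ × ℝ))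
    (hκ : KappaHyp n κ) (E : Fin n → Fin n → Prop) (hE : IsPriorityGraph n κ E)
    (hacyc : ¬ HasCycle n E) (vbar : Fin n → ℝ) (hv : ∀ i, 0 < vbar i)
    (f : (Fin n → ℝ) → Fin n → ℝ) (hf : CtrlLawSpec n κ E vbar f)
    (x : Fin n → ℝ) (hx : x ∈ freeG n κ E) (v : ℕ → Fin n → ℝ)
    (hvr : ∀ k i, v k i = 0 ∨ v k i = vbar i)
    (hvfree : ∀ t : ℝ, 0 ≤ t → flowVel n x v t ∈ freeG n κ E) :
    ∀ t : ℝ, 0 ≤ t → flowVel n x v t ≤ clFlow n f x t := by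
  have hne : ∀ i j, E i j → i ≠ j := by
    rintro i j hij rfl
    exact ((hE i i).1 hij).2 hij
  have hwf := wellFounded_of_not_hasCycle hacyc
  have hstep : ∀ k : ℕ, x + ∑ l ∈ Finset.range k, v l ≤ clSeq n f x k →
      x + ∑ l ∈ Finset.range k, v l + v k ≤ clSeq n f x k + f (clSeq n f x k) := by
    intro k hk
    refine slot_domination hne hwf hv hf (hvr k) (fun t ht => ?_) hk fun i => ?_
    · rw [← flowVel_natCast_add x v k ht]
      exact hvfree _ (add_nonneg k.cast_nonneg ht.1)
    · obtain ⟨m, hm⟩ := exists_int_sum_sub_sum (fun l => hf.1 (clSeq n f x l) i)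
        (fun l => hvr l i) k
      refine ⟨m, ?_⟩
      rw [clSeq_eq_sum, ← hm]
      simp
  have hdom : ∀ k : ℕ, x + ∑ l ∈ Finset.range k, v l ≤ clSeq n f x k := by
    intro k
    induction k with
    | zero => simp [clSeq]
    | succ k ih =>
      rw [Finset.sum_range_succ, ← add_assoc]
      exact hstep k ih
  intro t ht i
  have hfrac : t - (⌊t⌋₊ : ℝ) ∈ Icc (0 : ℝ) 1 :=
    ⟨sub_nonneg.2 (Nat.floor_le ht), by linarith [Nat.lt_floor_add_one t]⟩
  rw [clFlow, flowVel, flowVel, ← clSeq_eq_sum]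
  exact add_mul_le_add_mul_of_endpoints (hdom _ i) (hstep _ (hdom _) i) hfrac
end
end

section
/- (Liveness, velocity control.) Let G be an acyclic priority graph, v̄_i > 0 for each i, and f^G the associated control law. Then for every initial configuration x⁰ ∈ χ^free_G there exists T > 0 such that φ(T, x⁰, f^G) ∈ χ^goal, where χ^goal = x̄^obs + ℝ₊^n, i.e., φ_i(T, x⁰, f^G) ≥ x̄^obs_i for every robot i. -/
open Set

noncomputable section

/-- The obstacle region lies in a bounded region: there are `x̲^obs, x̄^obs ∈ χ^free`
bounding every collision cylinder in the relevant coordinates. -/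
def ObsBounds (n : ℕ) (κ : Fin n → Fin n → Set (ℝ × ℝ))
    (xlo xhi : Fin n → ℝ) : Prop :=
  xlo ∈ freeRegion n κ ∧ xhi ∈ freeRegion n κ ∧
  ∀ i j : Fin n, ∀ x ∈ cyl n κ i j,
    (xlo i < x i ∧ x i < xhi i) ∧ (xlo j < x j ∧ x j < xhi j)

/-- A nonempty chain of `E`-steps from `a` to `b` can be listed as a sequence. -/
theorem exists_seq_of_transGen {α : Type*} {E : α → α → Prop} {a b : α}
    (h : Relation.TransGen E a b) :
    ∃ (m : ℕ) (v : ℕ → α), 0 < m ∧ v 0 = a ∧ v m = b ∧ ∀ k < m, E (v k) (v (k + 1)) := by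
  induction h using Relation.TransGen.head_induction_on with
  | single h =>
    rename_i a
    refine ⟨1, fun k => if k = 0 then a else b, one_pos, by simp, by simp, ?_⟩
    intro k hk
    obtain rfl : k = 0 := by omega
    simpa using h
  | head h _hcb ih =>
    rename_i a c
    obtain ⟨m, v, -, h0, hm, hs⟩ := ih
    refine ⟨m + 1, fun k => Nat.casesOn k a v, m.succ_pos, rfl, hm, ?_⟩
    rintro (_ | k) hk
    · simpa [h0] using h
    · exact hs k (by omega)

theorem lt_of_mem_cylPr {n : ℕ} {κ : Fin n → Fin n → Set (ℝ × ℝ)} {xlo xhi : Fin n → ℝ}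
    (hbd : ObsBounds n κ xlo xhi) {i j : Fin n} (hij : i ≠ j) {z : Fin n → ℝ}
    (hz : z ∈ cylPr n κ i j) : z i < xhi i := by
  obtain ⟨y, hy, a, b, ha, -, rfl⟩ := hz
  have := (hbd.2.2 i j y hy).1.2
  simp [basisVec, hij]
  linarith

/-- A robot all of whose predecessors have cleared the obstacle region does not brake. -/
theorem ctrl_eq_vbar {n : ℕ} {κ : Fin n → Fin n → Set (ℝ × ℝ)} {xlo xhi : Fin n → ℝ}
    (hbd : ObsBounds n κ xlo xhi) {E : Fin n → Fin n → Prop} (hirr : ∀ i, ¬ E i i)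
    {vbar : Fin n → ℝ} {f : (Fin n → ℝ) → Fin n → ℝ} (hf : CtrlLawSpec n κ E vbar f)
    {x : Fin n → ℝ} (hnn : ∀ j, 0 ≤ f x j) {i : Fin n} (hx : ∀ j, E j i → xhi j ≤ x j) :
    f x i = vbar i := by
  refine (hf.2 x i).2 ?_
  rintro ⟨j, hj, t, ht, hmem⟩
  have hji : j ≠ i := by
    rintro rfl
    exact hirr j hj
  have hlt := lt_of_mem_cylPr hbd hji hmem
  have hmul := mul_nonneg ht.1 (hnn j)
  have := hx j hj
  simp [basisVec, hji] at hlt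
  linarith

theorem clFlow_natCast {n : ℕ} (f : (Fin n → ℝ) → Fin n → ℝ) (x : Fin n → ℝ) (k : ℕ) :
    clFlow n f x k = clSeq n f x k := by
  simp [clFlow, flowVel, clSeq_eq_sum f x k]

/-- liveness, velocity control: from any initial configuration in
`χ^free_G`, the closed-loop flow of the control law `f^G` reaches the goal region
`χ^goal = x̄^obs + ℝ₊^n` at some time `T > 0`. -/
theorem stmt18 (n : ℕ) (hn : 1 ≤ n) (κ : Fin n → Fin n → Set (ℝ × ℝ))
    (hκ : KappaHyp n κ) (xlo xhi : Fin n → ℝ) (hbd : ObsBounds n κ xlo xhi)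
    (E : Fin n → Fin n → Prop) (hE : IsPriorityGraph n κ E)
    (hacyc : ¬ HasCycle n E) (vbar : Fin n → ℝ) (hv : ∀ i, 0 < vbar i)
    (f : (Fin n → ℝ) → Fin n → ℝ) (hf : CtrlLawSpec n κ E vbar f)
    (x0 : Fin n → ℝ) (hx0 : x0 ∈ freeG n κ E) :
    ∃ T : ℝ, 0 < T ∧ ∀ i : Fin n, xhi i ≤ clFlow n f x0 T i := by
  have hwf := wellFounded_of_not_hasCycle hacyc
  have hnn : ∀ x j, 0 ≤ f x j := fun x j => by
    rcases hf.1 x j with h | h <;> rw [h]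
    exact (hv j).le
  have key : ∀ i, ∃ K : ℕ, ∀ k ≥ K, xhi i ≤ clSeq n f x0 k i := by
    intro i
    induction i using hwf.induction with
    | _ i ih =>
    choose! K hK using ih
    set N := Finset.univ.sup K
    have hstep : ∀ k ≥ N, f (clSeq n f x0 k) i = vbar i := fun k hk =>
      ctrl_eq_vbar hbd (fun j => hwf.irrefl.irrefl j) hf (hnn _) fun j hj =>
        hK j hj k ((Finset.le_sup (Finset.mem_univ j)).trans hk)
    have hlin : ∀ m : ℕ, clSeq n f x0 (N + m) i = clSeq n f x0 N i + m * vbar i := by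
      intro m
      induction m with
      | zero => simp
      | succ m ihm =>
        rw [← add_assoc, clSeq, Pi.add_apply, ihm, hstep _ (Nat.le_add_right N m)]
        push_cast
        ring
    obtain ⟨M, hM⟩ := exists_nat_ge ((xhi i - clSeq n f x0 N i) / vbar i)
    rw [div_le_iff₀ (hv i)] at hM
    refine ⟨N + M, fun k hk => ?_⟩
    obtain ⟨d, rfl⟩ := Nat.exists_eq_add_of_le hk
    rw [add_assoc, hlin]
    have := mul_nonneg d.cast_nonneg (hv i).le
    push_cast
    linarith
  choose K hK using key
  refine ⟨((Finset.univ.sup K + 1 : ℕ) : ℝ), by positivity, fun i => ?_⟩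
  rw [clFlow_natCast]
  exact hK i _ ((Finset.le_sup (Finset.mem_univ i)).trans (Nat.le_succ _))
end
end

section
/- (A broad class of priority preserving controls under kinodynamic constraints.) Let G be a priority graph, let s ∈ B_G be a brake-safe initial state, and let u be any admissible control satisfying, for every k ∈ ℕ, u(k) ≤ g^G(φ(k, s, u)) componentwise. Then the set of brake-safe states is positively invariant in discrete time, i.e., φ(k, s, u) ∈ B_G for all k ∈ ℕ, and the configuration remains priority-respecting in continuous time, i.e., φ_x(t, s, u) ∈ χ^free_G for all t ≥ 0. -/
open Set

noncomputable section

open scoped Classical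

/-- Saturated velocity of the robots within one time slot: starting from velocities
`v0` and applying constant acceleration `u`, at offset `τ` robot `i` has velocity
`max 0 (min (v̄ i) (v0 i + u i * τ))`. -/
def velSlot (n : ℕ) (vbar v0 u : Fin n → ℝ) (τ : ℝ) : Fin n → ℝ :=
  fun i => max 0 (min (vbar i) (v0 i + u i * τ))

/-- Positions within one time slot: starting from positions `x0` and velocities `v0`,
with constant acceleration `u`, robot `i` is at `x0 i + ∫₀^τ (velocity at σ) dσ`. -/
def posSlot (n : ℕ) (vbar x0 v0 u : Fin n → ℝ) (τ : ℝ) : Fin n → ℝ :=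
  fun i => x0 i + ∫ σ in (0:ℝ)..τ, velSlot n vbar v0 u σ i

/-- State (positions, velocities) of the system at the beginning of each time slot,
starting from state `s` with slotwise constant control `u`. -/
def stateAt (n : ℕ) (vbar : Fin n → ℝ) (s : (Fin n → ℝ) × (Fin n → ℝ))
    (u : ℕ → Fin n → ℝ) : ℕ → (Fin n → ℝ) × (Fin n → ℝ)
  | 0 => s
  | k + 1 =>
    ⟨posSlot n vbar (stateAt n vbar s u k).1 (stateAt n vbar s u k).2 (u k) 1,
     velSlot n vbar (stateAt n vbar s u k).2 (u k) 1⟩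

/-- Configuration part `φ_x(t, s, u)` of the continuous-time flow. -/
def flowX (n : ℕ) (vbar : Fin n → ℝ) (s : (Fin n → ℝ) × (Fin n → ℝ))
    (u : ℕ → Fin n → ℝ) (t : ℝ) : Fin n → ℝ :=
  posSlot n vbar (stateAt n vbar s u ⌊t⌋₊).1 (stateAt n vbar s u ⌊t⌋₊).2 (u ⌊t⌋₊)
    (t - (⌊t⌋₊ : ℝ))

/-- The constant maximal-brake control `u̲`. -/
def brakeCtrl (n : ℕ) (ul : Fin n → ℝ) : ℕ → Fin n → ℝ := fun _ => ul

/-- Brake-safe states `B_G`: under maximal braking, the configuration stays in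
`χ^free_G` forever. -/
def BrakeSafe (n : ℕ) (κ : Fin n → Fin n → Set (ℝ × ℝ)) (E : Fin n → Fin n → Prop)
    (vbar ul : Fin n → ℝ) (s : (Fin n → ℝ) × (Fin n → ℝ)) : Prop :=
  ∀ t : ℝ, 0 ≤ t → flowX n vbar s (brakeCtrl n ul) t ∈ freeG n κ E

/-- The worst-case control `ũ^i`: robot `i` applies the impulse control (maximal
throttle on slot `0`, maximal brake afterwards) while every other robot brakes. -/
def utilde (n : ℕ) (ul uu : Fin n → ℝ) (i : Fin n) : ℕ → Fin n → ℝ :=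
  fun k j => if j = i then (if k = 0 then uu i else ul i) else ul j

/-- The priority preserving control law `g^G`: robot `i` brakes maximally if the
worst-case flow `φ_x(·, s, ũ^i)` violates some priority `j ≻ i` with `(j,i) ∈ E(G)`,
and accelerates maximally otherwise. -/
def gG (n : ℕ) (κ : Fin n → Fin n → Set (ℝ × ℝ)) (E : Fin n → Fin n → Prop)
    (vbar ul uu : Fin n → ℝ) (s : (Fin n → ℝ) × (Fin n → ℝ)) : Fin n → ℝ :=
  fun i =>
    if ∃ j, E j i ∧ ∃ t : ℝ, 0 ≤ t ∧ flowX n vbar s (utilde n ul uu i) t ∈ cylPr n κ j i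
    then ul i else uu i

/-- The completed cylinder `j ≻ i` is stable under moving robot `j` back and robot `i` forward,
whatever the other robots do. -/
lemma cylPr_of_le {n : ℕ} {κ : Fin n → Fin n → Set (ℝ × ℝ)} {i j : Fin n} (hij : j ≠ i)
    {z z' : Fin n → ℝ} (hz : z ∈ cylPr n κ j i) (hj : z' j ≤ z j) (hi : z i ≤ z' i) :
    z' ∈ cylPr n κ j i := by
  obtain ⟨y, hy, a, b, ha, hb, rfl⟩ := hz
  simp only [basisVec, Pi.add_apply, Pi.sub_apply, Pi.smul_apply, Pi.single_eq_same,
    Pi.single_eq_of_ne hij, Pi.single_eq_of_ne hij.symm, smul_eq_mul, mul_one, mul_zero,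
    add_zero, sub_zero] at hj hi
  refine ⟨z' + (y j - z' j) • basisVec n j - (z' i - y i) • basisVec n i, ?_,
    y j - z' j, z' i - y i, by linarith, by linarith, by abel⟩
  simpa [cyl, basisVec, hij, hij.symm] using hy

lemma velSlot_apply_le {n : ℕ} (vbar : Fin n → ℝ) {v v' u u' : Fin n → ℝ} {i : Fin n}
    (hv : v i ≤ v' i) (hu : u i ≤ u' i) {τ : ℝ} (hτ : 0 ≤ τ) :
    velSlot n vbar v u τ i ≤ velSlot n vbar v' u' τ i := by
  unfold velSlot
  gcongr

lemma continuous_velSlot_apply {n : ℕ} (vbar v u : Fin n → ℝ) (i : Fin n) :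
    Continuous fun τ => velSlot n vbar v u τ i := by
  unfold velSlot
  fun_prop

lemma posSlot_apply_le {n : ℕ} (vbar : Fin n → ℝ) {x x' v v' u u' : Fin n → ℝ} {i : Fin n}
    (hx : x i ≤ x' i) (hv : v i ≤ v' i) (hu : u i ≤ u' i) {τ : ℝ} (hτ : 0 ≤ τ) :
    posSlot n vbar x v u τ i ≤ posSlot n vbar x' v' u' τ i :=
  add_le_add hx <| intervalIntegral.integral_mono_on hτ
    ((continuous_velSlot_apply vbar v u i).intervalIntegrable _ _)
    ((continuous_velSlot_apply vbar v' u' i).intervalIntegrable _ _)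
    fun _ hσ => velSlot_apply_le vbar hv hu hσ.1

lemma stateAt_apply_le {n : ℕ} (vbar : Fin n → ℝ) (s : (Fin n → ℝ) × (Fin n → ℝ))
    {u u' : ℕ → Fin n → ℝ} {i : Fin n} (hu : ∀ k, u k i ≤ u' k i) (k : ℕ) :
    (stateAt n vbar s u k).1 i ≤ (stateAt n vbar s u' k).1 i ∧
      (stateAt n vbar s u k).2 i ≤ (stateAt n vbar s u' k).2 i := by
  induction k with
  | zero => exact ⟨le_rfl, le_rfl⟩
  | succ k ih =>
    exact ⟨posSlot_apply_le vbar ih.1 ih.2 (hu k) zero_le_one,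
      velSlot_apply_le vbar ih.2 (hu k) zero_le_one⟩

/-- Each robot's position is monotone in its own control. -/
lemma flowX_apply_le {n : ℕ} (vbar : Fin n → ℝ) (s : (Fin n → ℝ) × (Fin n → ℝ))
    {u u' : ℕ → Fin n → ℝ} {i : Fin n} (hu : ∀ k, u k i ≤ u' k i) {t : ℝ} (ht : 0 ≤ t) :
    flowX n vbar s u t i ≤ flowX n vbar s u' t i :=
  posSlot_apply_le vbar (stateAt_apply_le vbar s hu _).1 (stateAt_apply_le vbar s hu _).2 (hu _)
    (sub_nonneg.2 (Nat.floor_le ht))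

lemma stateAt_succ' {n : ℕ} (vbar : Fin n → ℝ) (s : (Fin n → ℝ) × (Fin n → ℝ))
    (u : ℕ → Fin n → ℝ) (k : ℕ) :
    stateAt n vbar s u (k + 1) =
      stateAt n vbar (stateAt n vbar s u 1) (fun m => u (m + 1)) k := by
  induction k with
  | zero => rfl
  | succ k ih =>
    rw [stateAt, ih]
    rfl

lemma flowX_add_one {n : ℕ} (vbar : Fin n → ℝ) (s : (Fin n → ℝ) × (Fin n → ℝ))
    (u : ℕ → Fin n → ℝ) {t : ℝ} (ht : 0 ≤ t) :
    flowX n vbar s u (t + 1) =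
      flowX n vbar (stateAt n vbar s u 1) (fun m => u (m + 1)) t := by
  unfold flowX
  rw [Nat.floor_add_one ht, stateAt_succ', Nat.cast_add_one, add_sub_add_right_eq_sub]

/-- The control applying `w` on slot `0` and braking maximally afterwards. -/
def brakeAfter {n : ℕ} (ul w : Fin n → ℝ) : ℕ → Fin n → ℝ :=
  fun k => if k = 0 then w else ul

/-- From a brake-safe state, a first slot dominated by `g^G` followed by maximal braking
respects all priorities. -/
lemma flowX_brakeAfter_mem_freeG {n : ℕ} {κ : Fin n → Fin n → Set (ℝ × ℝ)}
    (hκ : ∀ i, κ i i = ∅) {E : Fin n → Fin n → Prop} {vbar ul uu : Fin n → ℝ}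
    {s : (Fin n → ℝ) × (Fin n → ℝ)} (hs : BrakeSafe n κ E vbar ul s) {w : Fin n → ℝ}
    (hw : ul ≤ w) (hg : w ≤ gG n κ E vbar ul uu s) {t : ℝ} (ht : 0 ≤ t) :
    flowX n vbar s (brakeAfter ul w) t ∈ freeG n κ E := by
  simp only [freeG, obsG, mem_compl_iff, mem_iUnion, not_exists]
  intro j i hE hmem
  have hji : j ≠ i := by
    rintro rfl
    obtain ⟨y, hy, -⟩ := hmem
    simp [cyl, hκ] at hy
  have brake_le : ∀ k l, ul l ≤ brakeAfter ul w k l := fun k l => by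
    unfold brakeAfter
    split_ifs
    exacts [hw l, le_rfl]
  have hgi := hg i
  unfold gG at hgi
  split_ifs at hgi with hbrake
  · refine hs t ht (mem_iUnion.2 ⟨j, mem_iUnion₂.2 ⟨i, hE, cylPr_of_le hji hmem ?_ ?_⟩⟩)
    · exact flowX_apply_le vbar s (fun k => brake_le k j) ht
    · refine flowX_apply_le vbar s (fun k => ?_) ht
      unfold brakeAfter brakeCtrl
      split_ifs
      exacts [hgi, le_rfl]
  · refine hbrake ⟨j, hE, t, ht, cylPr_of_le hji hmem ?_ ?_⟩
    · refine flowX_apply_le vbar s (fun k => ?_) ht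
      simpa [utilde, hji] using brake_le k j
    · refine flowX_apply_le vbar s (fun k => ?_) ht
      simp only [brakeAfter, utilde, if_true]
      split_ifs
      exacts [hgi, le_rfl]

/-- a broad class of priority preserving controls: if the initial state
is brake safe and the admissible control `u` satisfies `u k ≤ g^G(φ(k, s, u))`
componentwise at every slot, then the state at every integer time is brake safe and
the configuration remains in `χ^free_G` at all continuous times. -/
theorem stmt19 (n : ℕ) (hn : 1 ≤ n) (κ : Fin n → Fin n → Set (ℝ × ℝ))
    (hκ : KappaHyp n κ) (E : Fin n → Fin n → Prop) (hE : IsPriorityGraph n κ E)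
    (vbar ul uu : Fin n → ℝ) (hvbar : ∀ i, 0 < vbar i)
    (hul : ∀ i, ul i < 0) (huu : ∀ i, 0 < uu i)
    (s : (Fin n → ℝ) × (Fin n → ℝ)) (hsv : ∀ i, s.2 i ∈ Icc 0 (vbar i))
    (hs : BrakeSafe n κ E vbar ul s)
    (u : ℕ → Fin n → ℝ) (hadm : ∀ k i, u k i ∈ Icc (ul i) (uu i))
    (hle : ∀ k i, u k i ≤ gG n κ E vbar ul uu (stateAt n vbar s u k) i) :
    (∀ k : ℕ, BrakeSafe n κ E vbar ul (stateAt n vbar s u k)) ∧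
    (∀ t : ℝ, 0 ≤ t → flowX n vbar s u t ∈ freeG n κ E) := by
  have key : ∀ k, BrakeSafe n κ E vbar ul (stateAt n vbar s u k) → ∀ t : ℝ, 0 ≤ t →
      flowX n vbar (stateAt n vbar s u k) (brakeAfter ul (u k)) t ∈ freeG n κ E :=
    fun k hk t ht => flowX_brakeAfter_mem_freeG hκ.2.2.2.1 hk (fun i => (hadm k i).1) (hle k) ht
  have safe : ∀ k, BrakeSafe n κ E vbar ul (stateAt n vbar s u k) := by
    intro k
    induction k with
    | zero => exact hs
    | succ k ih =>
      intro t ht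
      have h := key k ih (t + 1) (by linarith)
      rwa [flowX_add_one _ _ _ ht] at h
  refine ⟨safe, fun t ht => ?_⟩
  have h := key ⌊t⌋₊ (safe _) (t - ⌊t⌋₊) (sub_nonneg.2 (Nat.floor_le ht))
  have hfloor : ⌊t - (⌊t⌋₊ : ℝ)⌋₊ = 0 :=
    Nat.floor_eq_zero.2 (by linarith [Nat.lt_floor_add_one t])
  unfold flowX at h
  rw [hfloor, Nat.cast_zero, sub_zero] at h
  exact h
end
end
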